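/- Let N ≥ 1 and n ≥ 0 be natural numbers and set Λ_n = n + n(n−1)/N. Define f : ℝ → ℝ by the everywhere-convergent power series f(λ) = Σ_{m=0}^{∞} binom(n+m, m) · λ^{n+m} / (N+2n)_m. Then f is twice differentiable and for every λ ∈ ℝ, −(λ²/N)·f''(λ) + (λ²/N − λ)·f'(λ) + (λ/N + Λ_n)·f(λ) = 0. -/

import Mathlib

/-- Pochhammer symbol `(x)_k = x (x+1) ⋯ (x+k-1)`, with `(x)_0 = 1`. -/
noncomputable def poch (x : ℝ) (k : ℕ) : ℝ := ∏ i ∈ Finset.range k, (x + i)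

/-- The coefficient sequence of the power series, extended by zero below degree `n`. -/
noncomputable def kummerCoeff (N n k : ℕ) : ℝ :=
  (k.choose n : ℝ) / poch ((N : ℝ) + 2 * n) (k - n)

lemma summable_derivCoeff {a : ℕ → ℝ} (ha : ∀ x : ℝ, Summable fun k => a k * x ^ k) (x : ℝ) :
    Summable fun k : ℕ => ((k : ℝ) + 1) * a (k + 1) * x ^ k := by
  have h := ((summable_nat_add_iff 1).2 (ha (2 * (|x| + 1)))).norm
  refine h.of_norm_bounded fun k => ?_
  have h2 : ((k : ℝ) + 1) ≤ 2 ^ (k + 1) := by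
    exact_mod_cast (Nat.lt_two_pow_self (n := k + 1)).le
  have hx : |x| ^ k ≤ (|x| + 1) ^ (k + 1) :=
    calc |x| ^ k ≤ (|x| + 1) ^ k := by gcongr; linarith
      _ ≤ (|x| + 1) ^ (k + 1) := pow_le_pow_right₀ (by linarith [abs_nonneg x]) k.le_succ
  have hk : |(k : ℝ) + 1| = k + 1 := abs_of_nonneg (by positivity)
  have hy : |(2 * (|x| + 1))| = 2 * (|x| + 1) := abs_of_nonneg (by positivity)
  rw [Real.norm_eq_abs, Real.norm_eq_abs, abs_mul, abs_mul, abs_mul, abs_pow, abs_pow, hk, hy,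
    mul_pow]
  calc ((k : ℝ) + 1) * |a (k + 1)| * |x| ^ k
      ≤ 2 ^ (k + 1) * |a (k + 1)| * (|x| + 1) ^ (k + 1) := by gcongr
    _ = _ := by ring

lemma hasDerivAt_tsum_mul_pow {a : ℕ → ℝ} (ha : ∀ x : ℝ, Summable fun k => a k * x ^ k) (x : ℝ) :
    HasDerivAt (fun y => ∑' k, a k * y ^ k) (∑' k : ℕ, ((k : ℝ) + 1) * a (k + 1) * x ^ k) x := by
  set R : ℝ := |x| + 1
  have hR : 0 < R := by positivity
  have hbound : Summable fun k : ℕ => ‖a k * (k * R ^ (k - 1))‖ := by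
    refine (summable_nat_add_iff 1).1 ((summable_derivCoeff ha R).norm.congr fun k => ?_)
    congr 1
    push_cast [Nat.add_sub_cancel]
    ring
  have hderiv := hasDerivAt_tsum_of_isPreconnected (g := fun k y => a k * y ^ k)
    (g' := fun k y => a k * (k * y ^ (k - 1))) (t := Metric.ball 0 R) (y₀ := 0) (y := x)
    hbound Metric.isOpen_ball (convex_ball 0 R).isPreconnected
    (fun k y _ => (hasDerivAt_pow k y).const_mul (a k))
    (fun k y hy => by
      have hy' : |y| ≤ |R| := by
        rw [abs_of_pos hR]; simpa using (mem_ball_zero_iff.1 hy).le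
      simp only [Real.norm_eq_abs, abs_mul, abs_pow]
      gcongr)
    (Metric.mem_ball_self hR) (ha 0) (by simp [R])
  have hsum : Summable fun k : ℕ => a k * (k * x ^ (k - 1)) := by
    refine (summable_nat_add_iff 1).1 ((summable_derivCoeff ha x).congr fun k => ?_)
    push_cast [Nat.add_sub_cancel]
    ring
  refine hderiv.congr_deriv ?_
  rw [hsum.tsum_eq_zero_add]
  simp only [Nat.cast_zero, zero_mul, mul_zero, zero_add]
  refine tsum_congr fun k => ?_
  push_cast [Nat.add_sub_cancel]
  ring

lemma poch_pos {x : ℝ} (hx : 0 < x) (k : ℕ) : 0 < poch x k :=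
  Finset.prod_pos fun i _ => by positivity

lemma poch_succ (x : ℝ) (k : ℕ) : poch x (k + 1) = poch x k * (x + k) :=
  Finset.prod_range_succ _ _

lemma factorial_le_poch {x : ℝ} (hx : 1 ≤ x) (k : ℕ) : (k.factorial : ℝ) ≤ poch x k := by
  induction k with
  | zero => simp [poch]
  | succ k ih =>
    rw [poch_succ, Nat.factorial_succ, mul_comm, Nat.cast_mul]
    have := (poch_pos (zero_lt_one.trans_le hx) k).le
    gcongr
    push_cast
    linarith

lemma one_le_cast_add_two_mul {N : ℕ} (hN : 1 ≤ N) (n : ℕ) : (1 : ℝ) ≤ (N : ℝ) + 2 * n := by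
  exact_mod_cast (by omega : 1 ≤ N + 2 * n)

lemma kummerCoeff_add_mul_pow (N n m : ℕ) (l : ℝ) :
    kummerCoeff N n (n + m) * l ^ (n + m) =
      (Nat.choose (n + m) m : ℝ) * l ^ (n + m) / poch ((N : ℝ) + 2 * n) m := by
  rw [kummerCoeff, Nat.add_sub_cancel_left, Nat.choose_symm_add]
  ring

lemma summable_series {N : ℕ} (hN : 1 ≤ N) (n : ℕ) (l : ℝ) : Summable fun m : ℕ =>
    (Nat.choose (n + m) m : ℝ) * l ^ (n + m) / poch ((N : ℝ) + 2 * n) m := by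
  refine ((Real.summable_pow_div_factorial (2 * |l|)).mul_left
    ((2 * |l|) ^ n)).of_norm_bounded fun m => ?_
  have hx := one_le_cast_add_two_mul hN n
  have hchoose : ((n + m).choose m : ℝ) ≤ 2 ^ (n + m) := by
    exact_mod_cast Nat.choose_le_two_pow _ _
  rw [Real.norm_eq_abs, abs_div, abs_mul, abs_pow, Nat.abs_cast,
    abs_of_pos (poch_pos (zero_lt_one.trans_le hx) m)]
  calc ((n + m).choose m : ℝ) * |l| ^ (n + m) / poch (N + 2 * n) m
      ≤ 2 ^ (n + m) * |l| ^ (n + m) / m.factorial := by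
        gcongr
        exact factorial_le_poch hx m
    _ = _ := by rw [← mul_pow, pow_add]; ring

lemma support_kummerCoeff_subset (N n : ℕ) (l : ℝ) :
    (Function.support fun k => kummerCoeff N n k * l ^ k) ⊆ Set.range (n + ·) := by
  intro k hk
  by_contra hkn
  have hlt : k < n := by
    by_contra! h
    exact hkn ⟨k - n, Nat.add_sub_cancel' h⟩
  simp [kummerCoeff, Nat.choose_eq_zero_of_lt hlt] at hk

lemma summable_kummerCoeff {N : ℕ} (hN : 1 ≤ N) (n : ℕ) (l : ℝ) :
    Summable fun k => kummerCoeff N n k * l ^ k := by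
  refine ((add_right_injective n).summable_iff fun k hk => ?_).1
    ((summable_series hN n l).congr fun m => (kummerCoeff_add_mul_pow N n m l).symm)
  exact Function.notMem_support.1 fun h => hk (support_kummerCoeff_subset N n l h)

lemma kummerCoeff_recurrence {N : ℕ} (hN : 1 ≤ N) (n k : ℕ) :
    ((k : ℝ) + 1) * kummerCoeff N n k =
      (((k : ℝ) + 1) * k + N * (k + 1) - (N * n + n * (n - 1))) * kummerCoeff N n (k + 1) := by
  rcases lt_trichotomy (k + 1) n with h | rfl | h
  · simp [kummerCoeff, Nat.choose_eq_zero_of_lt h, Nat.choose_eq_zero_of_lt (k.lt_succ_self.trans h)]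
  · rw [kummerCoeff, Nat.choose_eq_zero_of_lt k.lt_succ_self]
    push_cast
    ring
  · obtain ⟨m, rfl⟩ := Nat.exists_eq_add_of_le (Nat.le_of_lt_succ h)
    have hx := one_le_cast_add_two_mul hN n
    have hp := (poch_pos (zero_lt_one.trans_le hx) m).ne'
    have hq : (N : ℝ) + 2 * n + m ≠ 0 := by positivity
    have hc : ((n : ℝ) + m + 1) * (n + m).choose m = (n + m + 1).choose (m + 1) * (m + 1) := by
      exact_mod_cast Nat.add_one_mul_choose_eq (n + m) m
    have hs : (n + m + 1).choose n = (n + m + 1).choose (m + 1) :=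
      Nat.choose_symm_of_eq_add (by ring)
    rw [kummerCoeff, kummerCoeff, add_assoc n m 1, Nat.add_sub_cancel_left,
      Nat.add_sub_cancel_left, poch_succ, ← add_assoc, hs, Nat.choose_symm_add]
    field_simp
    push_cast
    linear_combination ((N : ℝ) + 2 * n + m) * hc

theorem stmt3 (N n : ℕ) (hN : 1 ≤ N)
    (Λn : ℝ) (hΛ : Λn = (n : ℝ) + (n : ℝ) * ((n : ℝ) - 1) / N)
    (f : ℝ → ℝ)
    (hf : ∀ l : ℝ, f l = ∑' m : ℕ,
      (Nat.choose (n + m) m : ℝ) * l ^ (n + m) / poch ((N : ℝ) + 2 * n) m) :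
    (∀ l : ℝ, Summable fun m : ℕ =>
      (Nat.choose (n + m) m : ℝ) * l ^ (n + m) / poch ((N : ℝ) + 2 * n) m) ∧
    Differentiable ℝ f ∧ Differentiable ℝ (deriv f) ∧
    ∀ l : ℝ,
      -(l ^ 2 / N) * deriv (deriv f) l + (l ^ 2 / N - l) * deriv f l +
        (l / N + Λn) * f l = 0 := by
  set a := kummerCoeff N n with ha_def
  have ha : ∀ x : ℝ, Summable fun k => a k * x ^ k := summable_kummerCoeff hN n
  have hf' : f = fun l => ∑' k, a k * l ^ k := by
    funext l
    rw [hf, ← (add_right_injective n).tsum_eq (support_kummerCoeff_subset N n l)]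
    exact tsum_congr fun m => (kummerCoeff_add_mul_pow N n m l).symm
  have ha1 := summable_derivCoeff ha
  have hd1 : ∀ x, HasDerivAt f (∑' k : ℕ, ((k : ℝ) + 1) * a (k + 1) * x ^ k) x := by
    rw [hf']
    exact hasDerivAt_tsum_mul_pow ha
  have ha2 := summable_derivCoeff ha1
  have hd2 := hasDerivAt_tsum_mul_pow ha1
  have hdf : deriv f = fun x => ∑' k : ℕ, ((k : ℝ) + 1) * a (k + 1) * x ^ k :=
    funext fun x => (hd1 x).deriv
  refine ⟨summable_series hN n, fun x => (hd1 x).differentiableAt,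
    hdf ▸ fun x => (hd2 x).differentiableAt, fun l => ?_⟩
  rw [hdf, (hd2 l).deriv, hf']
  have hN0 : (N : ℝ) ≠ 0 := by positivity
  have hΛ0 : Λn * a 0 = 0 := by
    rcases Nat.eq_zero_or_pos n with rfl | hn
    · simp [hΛ]
    · simp [ha_def, kummerCoeff, Nat.choose_eq_zero_of_lt hn]
  have s0 := (ha l).hasSum
  have s1 := (ha1 l).hasSum
  have s2 : HasSum (fun k : ℕ => ((k : ℝ) + 1) * k * a (k + 1) * l ^ (k + 1))
      (l ^ 2 * ∑' k : ℕ, ((k : ℝ) + 1) * ((((k + 1 : ℕ) : ℝ) + 1) * a (k + 1 + 1)) * l ^ k) := by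
    rw [← hasSum_nat_add_iff' 1]
    simp only [Finset.sum_range_one, Nat.cast_zero, mul_zero, zero_mul, sub_zero]
    refine (congrArg (HasSum · _) (funext fun k => ?_)).mpr
      ((ha2 l).hasSum.mul_left (l ^ 2))
    push_cast
    ring
  have t0 := (hasSum_nat_add_iff' 1).2 s0
  simp only [Finset.sum_range_one, pow_zero, mul_one] at t0
  have t1 : HasSum (fun k : ℕ => (k : ℝ) * a k * l ^ k)
      (l * ∑' k : ℕ, ((k : ℝ) + 1) * a (k + 1) * l ^ k) := by
    rw [← hasSum_nat_add_iff' 1]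
    simp only [Finset.sum_range_one, Nat.cast_zero, zero_mul, sub_zero]
    refine (congrArg (HasSum · _) (funext fun k => ?_)).mpr (s1.mul_left l)
    push_cast
    ring
  have total := ((((s2.mul_left (-1 / (N : ℝ))).add (t1.mul_left (l / N))).add
    (s1.mul_left (-l))).add (s0.mul_left (l / N))).add (t0.mul_left Λn)
  have hterm : ∀ k : ℕ, -1 / (N : ℝ) * (((k : ℝ) + 1) * k * a (k + 1) * l ^ (k + 1)) +
      l / N * (k * a k * l ^ k) + -l * (((k : ℝ) + 1) * a (k + 1) * l ^ k) +
      l / N * (a k * l ^ k) + Λn * (a (k + 1) * l ^ (k + 1)) = 0 := fun k => by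
    have hrec : ((k : ℝ) + 1) * a k = _ := kummerCoeff_recurrence hN n k
    rw [← ha_def] at hrec
    rw [hΛ]
    field_simp
    linear_combination l ^ (k + 1) * hrec
  simp only [hterm] at total
  have hzero := total.unique hasSum_zero
  linear_combination hzero + hΛ0
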